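/- Let n ≥ 1 and let A, B ∈ ℝ≥0^{n×n} be circulant matrices such that λ(A) = λ(B) and A_{ij} ≤ B_{ij} for all i, j. Then Attr(A) ⊆ Attr(B). -/

import Mathlib

open scoped NNReal Classical

namespace MaxAlg

variable {n : ℕ}

/-- cyclic successor on `Fin k` -/
def cyc {k : ℕ} (l : Fin k) : Fin k := ⟨(l.val + 1) % k, Nat.mod_lt _ l.pos⟩

/-- max-algebraic matrix product -/
noncomputable def mmul (A B : Matrix (Fin n) (Fin n) ℝ≥0) : Matrix (Fin n) (Fin n) ℝ≥0 :=
  fun i k => Finset.univ.sup fun j => A i j * B j k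

/-- max-algebraic identity matrix -/
def mId (n : ℕ) : Matrix (Fin n) (Fin n) ℝ≥0 := fun i j => if i = j then 1 else 0

/-- max-algebraic matrix power -/
noncomputable def mpow (A : Matrix (Fin n) (Fin n) ℝ≥0) : ℕ → Matrix (Fin n) (Fin n) ℝ≥0
  | 0 => mId n
  | t + 1 => mmul (mpow A t) A

/-- max-algebraic matrix-vector product -/
noncomputable def mvec (A : Matrix (Fin n) (Fin n) ℝ≥0) (x : Fin n → ℝ≥0) : Fin n → ℝ≥0 :=
  fun i => Finset.univ.sup fun j => A i j * x j

/-- geometric mean of the cycle `c` of length `k` -/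
noncomputable def cycMean (A : Matrix (Fin n) (Fin n) ℝ≥0) (k : ℕ) (c : Fin k → Fin n) : ℝ≥0 :=
  (∏ l : Fin k, A (c l) (c (cyc l))) ^ ((1 : ℝ) / (k : ℝ))

/-- maximum cycle geometric mean λ(A) -/
noncomputable def lam (A : Matrix (Fin n) (Fin n) ℝ≥0) : ℝ≥0 :=
  (Finset.Icc 1 n).sup fun k => Finset.univ.sup fun c : Fin k → Fin n => cycMean A k c

/-- attraction cone Attr(A) -/
def Attr (A : Matrix (Fin n) (Fin n) ℝ≥0) : Set (Fin n → ℝ≥0) :=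
  {x | ∃ s : ℕ, mvec (mpow A (s + 1)) x = fun i => lam A * mvec (mpow A s) x i}

/-- circulant matrix built from the vector of values `a_0, …, a_{n-1}` -/
def circ (a : Fin n → ℝ≥0) : Matrix (Fin n) (Fin n) ℝ≥0 := fun i j => a (j - i)

/-- A is a circulant matrix -/
def IsCirculant (A : Matrix (Fin n) (Fin n) ℝ≥0) : Prop := ∃ a : Fin n → ℝ≥0, A = circ a

/-- (i,j) is a critical edge of A -/
def IsCritEdge (A : Matrix (Fin n) (Fin n) ℝ≥0) (i j : Fin n) : Prop :=
  A i j ≠ 0 ∧ ∃ (k : ℕ) (c : Fin k → Fin n), 1 ≤ k ∧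
    (∀ l, A (c l) (c (cyc l)) ≠ 0) ∧
    cycMean A k c = lam A ∧ ∃ l, c l = i ∧ c (cyc l) = j

/-- there is a walk of length ≥ 1 from i to j in crit(A) -/
def CritWalk (A : Matrix (Fin n) (Fin n) ℝ≥0) (i j : Fin n) : Prop :=
  ∃ l : ℕ, 1 ≤ l ∧ ∃ w : ℕ → Fin n, w 0 = i ∧ w l = j ∧
    ∀ r < l, IsCritEdge A (w r) (w (r + 1))

/-- node i lies on a critical cycle of A -/
def OnCritCycle (A : Matrix (Fin n) (Fin n) ℝ≥0) (i : Fin n) : Prop :=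
  ∃ (k : ℕ) (c : Fin k → Fin n), 1 ≤ k ∧
    (∀ l, A (c l) (c (cyc l)) ≠ 0) ∧
    cycMean A k c = lam A ∧ ∃ l, c l = i

/-- family of one-dimensional intervals with bounds `lo`, `hi`,
each of one of the four forms -/
def IsIntervalFam (S : Fin n → Set ℝ≥0) (lo hi : Fin n → ℝ≥0) : Prop :=
  ∀ i, (S i).Nonempty ∧
    (S i = Set.Icc (lo i) (hi i) ∨ S i = Set.Ico (lo i) (hi i) ∨
     S i = Set.Ioc (lo i) (hi i) ∨ S i = Set.Ioo (lo i) (hi i))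

/-- the interval 𝐗 ⊆ ℝ≥0ⁿ determined by the family S -/
def box (S : Fin n → Set ℝ≥0) : Set (Fin n → ℝ≥0) := {x | ∀ i, x i ∈ S i}

/-- vertex x^{(k)}: x̄ in coordinate k and x̲ elsewhere -/
def vtx (lo hi : Fin n → ℝ≥0) (k : Fin n) : Fin n → ℝ≥0 :=
  Function.update lo k (hi k)

/-- the interval circulant matrix C(𝐚) determined by the interval family Sa -/
def Cset (Sa : Fin n → Set ℝ≥0) : Set (Matrix (Fin n) (Fin n) ℝ≥0) :=
  {A | ∃ a : Fin n → ℝ≥0, (∀ k, a k ∈ Sa k) ∧ A = circ a}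

/-- the matrix Â, with â_k = min(a̲, ā_k) where a̲ = max_k a̲_k -/
noncomputable def Ahat (alo ahi : Fin n → ℝ≥0) : Matrix (Fin n) (Fin n) ℝ≥0 :=
  circ fun k => min (Finset.univ.sup alo) (ahi k)

/-- the matrix A^{(k)} = Circulant(a̲_0,…,a̲_{k−1}, ā_k, a̲_{k+1},…,a̲_{n−1}) -/
def Ak (alo ahi : Fin n → ℝ≥0) (k : Fin n) : Matrix (Fin n) (Fin n) ℝ≥0 :=
  circ (Function.update alo k (ahi k))

end MaxAlg

namespace MaxAlg

variable {n : ℕ}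

theorem mvec_mId (x : Fin n → ℝ≥0) : mvec (mId n) x = x := by
  funext i
  apply le_antisymm
  · refine Finset.sup_le fun j _ => ?_
    by_cases h : i = j <;> simp [mId, h]
  · refine le_trans ?_ (Finset.le_sup (f := fun j => mId n i j * x j) (Finset.mem_univ i))
    simp [mId]

theorem mvec_mmul (A B : Matrix (Fin n) (Fin n) ℝ≥0) (x : Fin n → ℝ≥0) :
    mvec (mmul A B) x = mvec A (mvec B x) := by
  funext i
  simp only [mvec, mmul, NNReal.finset_sup_mul, NNReal.mul_finset_sup]
  rw [Finset.sup_comm]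
  simp only [mul_assoc]

theorem mvec_mpow (A : Matrix (Fin n) (Fin n) ℝ≥0) (s : ℕ) (x : Fin n → ℝ≥0) :
    mvec (mpow A s) x = (mvec A)^[s] x := by
  induction s generalizing x with
  | zero => exact mvec_mId x
  | succ s ih => rw [mpow, mvec_mmul, ih, Function.iterate_succ_apply]

theorem mem_Attr_iff (A : Matrix (Fin n) (Fin n) ℝ≥0) (x : Fin n → ℝ≥0) :
    x ∈ Attr A ↔ ∃ s : ℕ, (mvec A)^[s + 1] x = lam A • (mvec A)^[s] x := by
  simp only [Attr, Set.mem_ofPred_eq, mvec_mpow]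
  rfl

theorem mvec_mono (A : Matrix (Fin n) (Fin n) ℝ≥0) : Monotone (mvec A) := fun _ _ h _ =>
  Finset.sup_mono_fun fun j _ => mul_le_mul_right (h j) _

theorem mvec_smul (A : Matrix (Fin n) (Fin n) ℝ≥0) (c : ℝ≥0) (x : Fin n → ℝ≥0) :
    mvec A (c • x) = c • mvec A x := by
  funext i
  simp only [mvec, Pi.smul_apply, smul_eq_mul, NNReal.mul_finset_sup]
  exact Finset.sup_congr rfl fun j _ => mul_left_comm _ _ _

theorem smul_mvec (A : Matrix (Fin n) (Fin n) ℝ≥0) (c : ℝ≥0) (x : Fin n → ℝ≥0) :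
    mvec (c • A) x = c • mvec A x := by
  funext i
  simp only [mvec, Pi.smul_apply, Matrix.smul_apply, smul_eq_mul, NNReal.mul_finset_sup, mul_assoc]

theorem iterate_smul_mvec (A : Matrix (Fin n) (Fin n) ℝ≥0) (c : ℝ≥0) (s : ℕ)
    (x : Fin n → ℝ≥0) : (mvec (c • A))^[s] x = c ^ s • (mvec A)^[s] x := by
  induction s with
  | zero => simp
  | succ s ih =>
    rw [Function.iterate_succ_apply', ih, smul_mvec, mvec_smul, smul_smul, ← pow_succ',
      Function.iterate_succ_apply']

theorem mem_Attr_iff_of_lam_ne_zero (A : Matrix (Fin n) (Fin n) ℝ≥0) (h : lam A ≠ 0)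
    (x : Fin n → ℝ≥0) :
    x ∈ Attr A ↔ ∃ s : ℕ, (mvec ((lam A)⁻¹ • A))^[s + 1] x = (mvec ((lam A)⁻¹ • A))^[s] x := by
  rw [mem_Attr_iff]
  refine exists_congr fun s => ?_
  rw [iterate_smul_mvec, iterate_smul_mvec]
  have h' : (lam A)⁻¹ ^ (s + 1) ≠ 0 := pow_ne_zero _ (inv_ne_zero h)
  have e : (lam A)⁻¹ ^ s • (mvec A)^[s] x
      = (lam A)⁻¹ ^ (s + 1) • (lam A • (mvec A)^[s] x) := by
    rw [smul_smul, pow_succ, mul_assoc, inv_mul_cancel₀ h, mul_one]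
  rw [e]
  exact (smul_right_injective _ h').eq_iff.symm

theorem mvec_circ_apply [NeZero n] (a : Fin n → ℝ≥0) (x : Fin n → ℝ≥0) (i : Fin n) :
    mvec (circ a) x i = Finset.univ.sup fun t => a t * x (i + t) := by
  apply le_antisymm
  · refine Finset.sup_le fun j _ => ?_
    refine le_trans ?_ (Finset.le_sup (f := fun t => a t * x (i + t)) (Finset.mem_univ (j - i)))
    simp [circ]
  · refine Finset.sup_le fun t _ => ?_
    refine le_trans ?_ (Finset.le_sup (f := fun j => circ a i j * x j) (Finset.mem_univ (i + t)))
    simp [circ]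

theorem mvec_circ_comm [NeZero n] (a b : Fin n → ℝ≥0) :
    Function.Commute (mvec (circ a)) (mvec (circ b)) := by
  intro x
  funext i
  simp only [mvec_circ_apply, NNReal.mul_finset_sup]
  rw [Finset.sup_comm]
  refine Finset.sup_congr rfl fun t _ => Finset.sup_congr rfl fun u _ => ?_
  rw [add_right_comm, mul_left_comm]

theorem le_iterate_mvec_circ [NeZero n] (a : Fin n → ℝ≥0) (t : Fin n) (ht : a t = 1)
    (x : Fin n → ℝ≥0) : x ≤ (mvec (circ a))^[n] x := by
  have key : ∀ k : ℕ, ∀ i, x (i + k • t) ≤ (mvec (circ a))^[k] x i := by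
    intro k
    induction k with
    | zero => simp
    | succ k ih =>
      intro i
      rw [Function.iterate_succ_apply', mvec_circ_apply]
      refine le_trans ?_ (Finset.le_sup
        (f := fun u => a u * (mvec (circ a))^[k] x (i + u)) (Finset.mem_univ t))
      simpa [ht, succ_nsmul', add_assoc] using ih (i + t)
  intro i
  have hn : n • t = 0 := by simpa using card_nsmul_eq_zero (x := t)
  simpa [hn] using key n i

/-- Each coordinate of `g x` is attained at a single coordinate of `x` with a coefficient at most
one, and that term bounds `g` from below at every other vector. -/
def IsMaxLinearContraction (g : (Fin n → ℝ≥0) → Fin n → ℝ≥0) : Prop :=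
  ∀ x i, ∃ j, ∃ c ≤ 1, g x i = c * x j ∧ ∀ z, c * z j ≤ g z i

theorem IsMaxLinearContraction.comp {f g : (Fin n → ℝ≥0) → Fin n → ℝ≥0}
    (hf : IsMaxLinearContraction f) (hg : IsMaxLinearContraction g) :
    IsMaxLinearContraction (f ∘ g) := by
  intro x i
  obtain ⟨j, c, hc, h₁, h₂⟩ := hf (g x) i
  obtain ⟨k, d, hd, h₃, h₄⟩ := hg x j
  refine ⟨k, c * d, mul_le_one' hc hd, ?_, fun z => ?_⟩
  · rw [Function.comp_apply, h₁, h₃, mul_assoc]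
  · rw [mul_assoc]
    exact (mul_le_mul_right (h₄ z) c).trans (h₂ (g z))

theorem IsMaxLinearContraction.iterate {f : (Fin n → ℝ≥0) → Fin n → ℝ≥0}
    (hf : IsMaxLinearContraction f) (k : ℕ) : IsMaxLinearContraction f^[k] := by
  induction k with
  | zero => exact fun x i => ⟨i, 1, le_rfl, by simp, by simp⟩
  | succ k ih => exact ih.comp hf

theorem isMaxLinearContraction_mvec (A : Matrix (Fin n) (Fin n) ℝ≥0) (h : ∀ i j, A i j ≤ 1) :
    IsMaxLinearContraction (mvec A) := by
  intro x i
  obtain ⟨j, -, hj⟩ := Finset.exists_mem_eq_sup Finset.univ ⟨i, Finset.mem_univ i⟩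
    fun j => A i j * x j
  exact ⟨j, A i j, h i j, hj, fun z =>
    Finset.le_sup (f := fun j => A i j * z j) (Finset.mem_univ j)⟩

/-- An inflationary max-linear contraction of `ℝ≥0ⁿ` stabilizes after `n` steps. -/
theorem IsMaxLinearContraction.iterate_card_stable {g : (Fin n → ℝ≥0) → Fin n → ℝ≥0}
    (hg : IsMaxLinearContraction g) (hle : ∀ x, x ≤ g x) (x : Fin n → ℝ≥0) :
    g (g^[n] x) = g^[n] x := by
  have key : ∀ m i, g^[m] x i < g^[m + 1] x i →
      ∃ S : Finset (Fin n), S.card = m + 1 ∧ ∀ j ∈ S, g^[m + 1] x i ≤ g^[m + 1] x j := by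
    intro m
    induction m with
    | zero => exact fun i _ => ⟨{i}, by simp, by simp⟩
    | succ m ih =>
      intro i hi
      obtain ⟨j, c, hc, h₁, h₂⟩ := hg (g^[m + 1] x) i
      rw [← Function.iterate_succ_apply' g] at h₁
      have hj : g^[m] x j < g^[m + 1] x j := by
        by_contra! hcon
        have h₃ := h₂ (g^[m] x)
        rw [← Function.iterate_succ_apply' g] at h₃
        exact absurd (h₁.le.trans ((mul_le_mul_right hcon c).trans h₃)) hi.not_ge
      have hij : g^[m + 1 + 1] x i ≤ g^[m + 1] x j :=
        h₁.le.trans (mul_le_of_le_one_left' hc)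
      obtain ⟨S, hS, hSle⟩ := ih j hj
      have hiS : i ∉ S := fun h => (hi.trans_le (hij.trans (hSle i h))).false
      refine ⟨insert i S, by rw [Finset.card_insert_of_notMem hiS, hS], ?_⟩
      intro k hk
      rcases Finset.mem_insert.1 hk with rfl | hk
      · exact le_rfl
      · refine hij.trans ((hSle k hk).trans ?_)
        rw [Function.iterate_succ_apply' g (m + 1)]
        exact hle _ k
  rw [← Function.iterate_succ_apply' g]
  funext i
  by_contra hne
  have hle' : g^[n] x i ≤ g^[n + 1] x i := by
    rw [Function.iterate_succ_apply']
    exact hle _ i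
  obtain ⟨S, hS, -⟩ := key n i (lt_of_le_of_ne hle' (Ne.symm hne))
  have := S.card_le_univ
  simp [hS] at this

/-- If `f ≤ h` are commuting monotone self-maps, `f^[n]` is inflationary and `h` has a
periodic point `h^[N] x` of period `n`, then `h^[N] x` is fixed by `h` as soon as the `f`-orbit
of `x` stabilizes. -/
theorem iterate_fixed_of_le {α : Type*} [PartialOrder α] {f h : α → α} (hf : Monotone f)
    (hh : Monotone h) (hfh : ∀ z, f z ≤ h z) (hcomm : Function.Commute f h) {n : ℕ} (hn : 1 ≤ n)
    (hinfl : ∀ z, z ≤ f^[n] z) {x : α} {N s : ℕ} (hper : h^[n] (h^[N] x) = h^[N] x)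
    (hs : f^[s + 1] x = f^[s] x) : h^[N + 1] x = h^[N] x := by
  set z := h^[N] x with hz
  have hsz : f (f^[s] z) = f^[s] z := by
    rw [← Function.iterate_succ_apply' f, hz, (hcomm.iterate_iterate (s + 1) N).eq,
      (hcomm.iterate_iterate s N).eq, hs]
  have hfix : f (f^[n * s] z) = f^[n * s] z := by
    obtain ⟨d, hd⟩ := Nat.exists_eq_add_of_le' (Nat.le_mul_of_pos_left s hn)
    have : f^[n * s] z = f^[s] z := by
      rw [hd, Function.iterate_add_apply]
      exact Function.iterate_fixed hsz d
    rw [this, hsz]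
  have hle₁ : z ≤ f^[n * s] z := by
    rw [Function.iterate_mul]
    exact Function.id_le_iterate_of_id_le hinfl s z
  have hle₂ : f^[n * s] z ≤ z := by
    refine (hf.iterate_le_of_le hfh (n * s) z).trans_eq ?_
    rw [Function.iterate_mul]
    exact Function.iterate_fixed hper s
  rw [le_antisymm hle₂ hle₁] at hfix
  have hzh : z ≤ h z := hfix.symm.le.trans (hfh z)
  rw [Function.iterate_succ_apply']
  refine le_antisymm ?_ hzh
  have := hh.monotone_iterate_of_le_map hzh hn
  simpa [hper] using this

theorem lam_circ [NeZero n] (a : Fin n → ℝ≥0) : lam (circ a) = Finset.univ.sup a := by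
  apply le_antisymm
  · refine Finset.sup_le fun k hk => Finset.sup_le fun c _ => ?_
    have hk0 : k ≠ 0 := by have := (Finset.mem_Icc.1 hk).1; omega
    have hprod : ∏ l : Fin k, circ a (c l) (c (cyc l)) ≤ (Finset.univ.sup a) ^ k := by
      simpa using Finset.prod_le_pow_card Finset.univ
        (fun l : Fin k => circ a (c l) (c (cyc l))) (Finset.univ.sup a)
        fun l _ => Finset.le_sup (f := a) (Finset.mem_univ _)
    rw [cycMean, one_div]
    exact (NNReal.rpow_le_rpow hprod (by positivity)).trans_eq (NNReal.pow_rpow_inv_natCast _ hk0)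
  · refine Finset.sup_le fun t _ => ?_
    have hn0 : n ≠ 0 := NeZero.ne n
    have hnt : n • t = 0 := by simpa using card_nsmul_eq_zero (x := t)
    let c : Fin n → Fin n := fun l => l.val • t
    have hmod : ∀ m : ℕ, (m % n) • t = m • t := fun m => by
      conv_rhs => rw [← Nat.mod_add_div m n, add_nsmul, mul_comm, mul_nsmul', hnt, nsmul_zero,
        add_zero]
    have hedge : ∀ l, circ a (c l) (c (cyc l)) = a t := fun l => by
      simp [circ, c, cyc, hmod, succ_nsmul]
    have hmean : cycMean (circ a) n c = a t := by
      rw [cycMean, one_div, Finset.prod_congr rfl fun l _ => hedge l]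
      simpa using NNReal.pow_rpow_inv_natCast (a t) hn0
    rw [← hmean]
    exact (Finset.le_sup (f := fun c : Fin n → Fin n => cycMean (circ a) n c)
      (Finset.mem_univ c)).trans
      (Finset.le_sup (f := fun k => Finset.univ.sup fun c : Fin k → Fin n => cycMean (circ a) k c)
        (Finset.mem_Icc.2 ⟨Nat.one_le_iff_ne_zero.2 hn0, le_rfl⟩))

theorem le_lam_circ [NeZero n] (a : Fin n → ℝ≥0) (t : Fin n) : a t ≤ lam (circ a) := by
  rw [lam_circ]
  exact Finset.le_sup (Finset.mem_univ t)

theorem exists_eq_lam_circ [NeZero n] (a : Fin n → ℝ≥0) : ∃ t, a t = lam (circ a) := by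
  obtain ⟨t, -, ht⟩ := Finset.exists_mem_eq_sup Finset.univ ⟨0, Finset.mem_univ (0 : Fin n)⟩ a
  exact ⟨t, by rw [lam_circ, ht]⟩

end MaxAlg

open MaxAlg in
/-- For circulant `A ≤ B` with `λ(A) = λ(B)`, `Attr(A) ⊆ Attr(B)`. -/
theorem attr_subset_of_circulant_le
    (n : ℕ) (hn : 1 ≤ n) (A B : Matrix (Fin n) (Fin n) ℝ≥0)
    (hA : IsCirculant A) (hB : IsCirculant B)
    (hlam : lam A = lam B) (hle : ∀ i j, A i j ≤ B i j) :
    Attr A ⊆ Attr B := by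
  have : NeZero n := ⟨by omega⟩
  obtain ⟨a, rfl⟩ := hA
  obtain ⟨b, rfl⟩ := hB
  intro x hx
  by_cases h0 : lam (circ b) = 0
  · refine (mem_Attr_iff _ _).2 ⟨0, ?_⟩
    have hb : ∀ t, b t = 0 := fun t => le_zero_iff.1 ((le_lam_circ b t).trans_eq h0)
    funext i
    simp [mvec_circ_apply, hb, h0]
  · have h0' : lam (circ a) ≠ 0 := hlam ▸ h0
    rw [mem_Attr_iff_of_lam_ne_zero _ h0]
    obtain ⟨s, hs⟩ := (mem_Attr_iff_of_lam_ne_zero _ h0' _).1 hx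
    rw [hlam] at hs
    set L := lam (circ b) with hL
    have hsmul : ∀ d : Fin n → ℝ≥0, L⁻¹ • circ d = circ (L⁻¹ • d) := fun d => rfl
    rw [hsmul] at hs ⊢
    have hone : ∀ d : Fin n → ℝ≥0, lam (circ d) = L → ∃ t, (L⁻¹ • d) t = 1 := fun d hd => by
      obtain ⟨t, ht⟩ := exists_eq_lam_circ d
      exact ⟨t, by simp [ht, hd, h0]⟩
    obtain ⟨t, ht⟩ := hone a hlam
    obtain ⟨u, hu⟩ := hone b rfl
    have hcontr : IsMaxLinearContraction (mvec (circ (L⁻¹ • b))) := by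
      refine isMaxLinearContraction_mvec _ fun i j => ?_
      have := mul_le_mul_right (le_lam_circ b (j - i)) L⁻¹
      rwa [← hL, inv_mul_cancel₀ h0] at this
    refine ⟨n * n, iterate_fixed_of_le (mvec_mono _) (mvec_mono _) (fun z i => ?_)
      (mvec_circ_comm _ _) hn (le_iterate_mvec_circ _ t ht) ?_ hs⟩
    · exact Finset.sup_mono_fun fun j _ =>
        mul_le_mul_left (mul_le_mul_right (hle i j) L⁻¹) (z j)
    · rw [Function.iterate_mul]
      exact (hcontr.iterate n).iterate_card_stable (le_iterate_mvec_circ _ u hu) x
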